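/- Let T ⊆ F be a chain. Then T satisfies the uniform convergence condition (for every ε > 0 there exists N_ε ∈ ℕ such that |ν_N(A) − ν(A)| < ε for all A ∈ T and all N > N_ε) if and only if there exists a maximal chain U ⊆ P(ℕ) (maximal in the sense that U is not a proper subset of any other chain in P(ℕ)) such that U ⊆ F, T ⊆ U, and {ν(A) : A ∈ U} = [0,1]. -/

import Mathlib

/-- The partial average `ν_N(A) = (1/N)·∑_{n=1}^N 1_A(n)`. -/
noncomputable def nuN (A : Set ℕ) (N : ℕ) : ℝ :=
  (∑ n ∈ Finset.Icc 1 N, A.indicator (fun _ => (1 : ℝ)) n) / N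

/-- The upper Cesàro limit `ν⁺(A)`. -/
noncomputable def nuPlus (A : Set ℕ) : ℝ :=
  Filter.limsup (fun N => nuN A N) Filter.atTop

/-- The lower Cesàro limit `ν⁻(A)`. -/
noncomputable def nuMinus (A : Set ℕ) : ℝ :=
  Filter.liminf (fun N => nuN A N) Filter.atTop

/-- `A ∈ F`: the Cesàro limit of `A` exists. -/
def memF (A : Set ℕ) : Prop :=
  ∃ l : ℝ, Filter.Tendsto (fun N => nuN A N) Filter.atTop (nhds l)

/-- The Cesàro limit `ν(A)`; it coincides with `ν⁺(A)` whenever `A ∈ F`. -/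
noncomputable def nu (A : Set ℕ) : ℝ := nuPlus A

/-- `A ∈ N`: `A` is a null set. -/
def nullSet (A : Set ℕ) : Prop := memF A ∧ nu A = 0

open Filter Topology

theorem nuN_nonneg (A : Set ℕ) (N : ℕ) : 0 ≤ nuN A N := by
  unfold nuN
  exact div_nonneg (Finset.sum_nonneg fun n _ => Set.indicator_nonneg (by simp) n) (by positivity)

theorem nuN_mono {A B : Set ℕ} (h : A ⊆ B) (N : ℕ) : nuN A N ≤ nuN B N := by
  unfold nuN
  gcongr with n

theorem nuN_univ {N : ℕ} (hN : 0 < N) : nuN Set.univ N = 1 := by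
  have : (N : ℝ) ≠ 0 := by positivity
  simp [nuN, this]

theorem nuN_empty (N : ℕ) : nuN ∅ N = 0 := by
  simp [nuN]

theorem nuN_le_one (A : Set ℕ) (N : ℕ) : nuN A N ≤ 1 := by
  rcases Nat.eq_zero_or_pos N with rfl | hN
  · simp [nuN]
  · exact (nuN_mono (Set.subset_univ A) N).trans (nuN_univ hN).le

theorem nuN_union {A B : Set ℕ} (h : Disjoint A B) (N : ℕ) :
    nuN (A ∪ B) N = nuN A N + nuN B N := by
  simp only [nuN, Set.indicator_union_of_disjoint h, Finset.sum_add_distrib, add_div]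

theorem nuN_congr {A B : Set ℕ} {N : ℕ} (h : ∀ n ≤ N, n ∈ A ↔ n ∈ B) : nuN A N = nuN B N := by
  unfold nuN
  congr 1
  refine Finset.sum_congr rfl fun n hn => ?_
  have := h n (Finset.mem_Icc.1 hn).2
  by_cases hA : n ∈ A
  · simp [hA, this.1 hA]
  · simp [hA, mt this.2 hA]

theorem nu_eq_of_tendsto {A : Set ℕ} {l : ℝ} (h : Tendsto (nuN A) atTop (𝓝 l)) : nu A = l :=
  h.limsup_eq

theorem memF.tendsto {A : Set ℕ} (h : memF A) : Tendsto (nuN A) atTop (𝓝 (nu A)) := by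
  obtain ⟨l, hl⟩ := h
  rwa [nu_eq_of_tendsto hl]

theorem nu_mono {A B : Set ℕ} (hA : memF A) (hB : memF B) (h : A ⊆ B) : nu A ≤ nu B :=
  le_of_tendsto_of_tendsto' hA.tendsto hB.tendsto (nuN_mono h)

theorem nu_mem_Icc {A : Set ℕ} (hA : memF A) : nu A ∈ Set.Icc (0 : ℝ) 1 :=
  ⟨ge_of_tendsto' hA.tendsto (nuN_nonneg A), le_of_tendsto' hA.tendsto (nuN_le_one A)⟩

theorem tendsto_nuN_empty : Tendsto (nuN ∅) atTop (𝓝 0) := by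
  simp [funext nuN_empty]

theorem tendsto_nuN_univ : Tendsto (nuN Set.univ) atTop (𝓝 1) :=
  tendsto_const_nhds.congr' <| by
    filter_upwards [eventually_gt_atTop 0] with N hN using (nuN_univ hN).symm

/-- In a chain of sets with a Cesàro limit, a strictly smaller limit forces inclusion. -/
theorem IsChain.subset_of_nu_lt {U : Set (Set ℕ)} (hU : IsChain (· ⊆ ·) U)
    (hF : ∀ A ∈ U, memF A) {A B : Set ℕ} (hA : A ∈ U) (hB : B ∈ U) (h : nu A < nu B) :
    A ⊆ B :=
  (hU.total hA hB).resolve_right fun hBA => (nu_mono (hF B hB) (hF A hA) hBA).not_gt h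

/-- A set of density `b` has a subset of density `s * b`, for every `s ∈ [0,1]`. -/
theorem exists_subset_tendsto_nuN {E : Set ℕ} {b s : ℝ} (hE : Tendsto (nuN E) atTop (𝓝 b))
    (hs0 : 0 ≤ s) (hs1 : s ≤ 1) :
    ∃ G ⊆ E, Tendsto (nuN G) atTop (𝓝 (s * b)) := by
  let e : ℕ → ℝ := fun N => ∑ n ∈ Finset.Icc 1 N, E.indicator (fun _ => (1 : ℝ)) n
  have he : ∀ N, e (N + 1) = e N + E.indicator (fun _ => (1 : ℝ)) (N + 1) := fun N =>
    Finset.sum_Icc_succ_top (by omega) _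
  let G : Set ℕ := {n | n ∈ E ∧ ⌊s * e (n - 1)⌋ < ⌊s * e n⌋}
  have hcount : ∀ N : ℕ,
      ∑ n ∈ Finset.Icc 1 N, G.indicator (fun _ => (1 : ℝ)) n = ⌊s * e N⌋ := by
    intro N
    induction N with
    | zero => simp [e]
    | succ N ih =>
      rw [Finset.sum_Icc_succ_top (by omega), ih]
      by_cases hN : N + 1 ∈ E
      · have h1 : e (N + 1) = e N + 1 := by simp [he, hN]
        have hle : ⌊s * e N⌋ ≤ ⌊s * e (N + 1)⌋ := by
          apply Int.floor_le_floor
          rw [h1]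
          nlinarith
        have hge : ⌊s * e (N + 1)⌋ ≤ ⌊s * e N⌋ + 1 := by
          rw [← Int.floor_add_one]
          apply Int.floor_le_floor
          rw [h1]
          nlinarith
        by_cases hlt : ⌊s * e N⌋ < ⌊s * e (N + 1)⌋
        · have hG : N + 1 ∈ G := ⟨hN, by simpa using hlt⟩
          have : ⌊s * e (N + 1)⌋ = ⌊s * e N⌋ + 1 := by omega
          simp [hG, this]
        · have hG : N + 1 ∉ G := fun h => hlt (by simpa using h.2)
          have : ⌊s * e (N + 1)⌋ = ⌊s * e N⌋ := by omega
          simp [hG, this]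
      · have hG : N + 1 ∉ G := fun h => hN h.1
        simp [hG, he, hN]
  refine ⟨G, fun n hn => hn.1, ?_⟩
  have hlow : Tendsto (fun N : ℕ => s * nuN E N - 1 / (N : ℝ)) atTop (𝓝 (s * b)) := by
    simpa using (hE.const_mul s).sub tendsto_one_div_atTop_nhds_zero_nat
  refine tendsto_of_tendsto_of_tendsto_of_le_of_le hlow (hE.const_mul s) (fun N => ?_) fun N => ?_
  · have hle : s * e N - 1 ≤ ⌊s * e N⌋ := (Int.sub_one_lt_floor _).le
    calc s * nuN E N - 1 / (N : ℝ) = (s * e N - 1) / N := by simp only [nuN, e]; ring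
      _ ≤ nuN G N := by
        unfold nuN
        rw [hcount]
        gcongr
  · calc nuN G N = ⌊s * e N⌋ / N := by rw [nuN, hcount]
      _ ≤ s * e N / N := by gcongr; exact Int.floor_le _
      _ = s * nuN E N := by simp only [nuN, e]; ring

/-- Intermediate densities are attained between two nested sets. -/
theorem exists_between_tendsto_nuN {L R : Set ℕ} {a b t : ℝ} (hLR : L ⊆ R)
    (hL : Tendsto (nuN L) atTop (𝓝 a)) (hR : Tendsto (nuN R) atTop (𝓝 b))
    (hat : a ≤ t) (htb : t ≤ b) :
    ∃ D, L ⊆ D ∧ D ⊆ R ∧ Tendsto (nuN D) atTop (𝓝 t) := by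
  have hE : Tendsto (nuN (R \ L)) atTop (𝓝 (b - a)) := by
    refine (hR.sub hL).congr fun N => ?_
    have := nuN_union (Set.disjoint_sdiff_right (s := L) (t := R)) N
    rw [Set.union_sdiff_cancel hLR] at this
    linarith
  obtain ⟨G, hGE, hG⟩ := exists_subset_tendsto_nuN hE (s := (t - a) / (b - a))
    (div_nonneg (by linarith) (by linarith)) (div_le_one_of_le₀ (by linarith) (by linarith))
  refine ⟨L ∪ G, Set.subset_union_left, Set.union_subset hLR (hGE.trans Set.sdiff_subset), ?_⟩
  have hdisj : Disjoint L G := Set.disjoint_sdiff_right.mono_right hGE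
  have hsum : a + (t - a) / (b - a) * (b - a) = t := by
    rw [div_mul_cancel_of_imp fun h => by linarith]
    ring
  rw [funext (nuN_union hdisj), ← hsum]
  exact hL.add hG

/-- The uniform convergence condition. -/
def UniformlyCesaro (T : Set (Set ℕ)) : Prop :=
  ∀ ε : ℝ, 0 < ε → ∃ N₀ : ℕ, ∀ A ∈ T, ∀ N : ℕ, N₀ < N → |nuN A N - nu A| < ε

theorem UniformlyCesaro.mono {S T : Set (Set ℕ)} (hT : UniformlyCesaro T) (h : S ⊆ T) :
    UniformlyCesaro S := fun ε hε =>
  (hT ε hε).imp fun _ hN A hA => hN A (h hA)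

theorem UniformlyCesaro.insert {T : Set (Set ℕ)} (hT : UniformlyCesaro T) {D : Set ℕ}
    (hD : memF D) : UniformlyCesaro (insert D T) := by
  intro ε hε
  obtain ⟨N₁, h₁⟩ := hT ε hε
  obtain ⟨N₂, h₂⟩ := Metric.tendsto_atTop.1 hD.tendsto ε hε
  refine ⟨max N₁ N₂, ?_⟩
  rintro A (rfl | hA) N hN
  · exact h₂ N ((le_max_right _ _).trans hN.le)
  · exact h₁ A hA N ((le_max_left _ _).trans_lt hN)

/-- The Cesàro limit exists for pointwise limits of a uniformly convergent family. -/
theorem UniformlyCesaro.memF_of_approx {S : Set (Set ℕ)} (hS : UniformlyCesaro S) {X : Set ℕ}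
    (hX : ∀ N, ∃ A ∈ S, ∀ n ≤ N, n ∈ X ↔ n ∈ A) : memF X := by
  refine cauchySeq_tendsto_of_complete (Metric.cauchySeq_iff'.2 fun ε hε => ?_)
  obtain ⟨N₀, h⟩ := hS (ε / 2) (half_pos hε)
  refine ⟨N₀ + 1, fun N hN => ?_⟩
  obtain ⟨A, hA, hXA⟩ := hX N
  rw [Real.dist_eq, nuN_congr hXA, nuN_congr fun n hn => hXA n (hn.trans hN)]
  have h1 := abs_lt.1 (h A hA N hN)
  have h2 := abs_lt.1 (h A hA (N₀ + 1) N₀.lt_succ_self)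
  exact abs_lt.2 ⟨by linarith, by linarith⟩

theorem UniformlyCesaro.exists_nu_near {S : Set (Set ℕ)} (hS : UniformlyCesaro S) {X : Set ℕ}
    (hX : ∀ N, ∃ A ∈ S, ∀ n ≤ N, n ∈ X ↔ n ∈ A) {ε : ℝ} (hε : 0 < ε) :
    ∃ A ∈ S, |nu X - nu A| < ε := by
  obtain ⟨N₀, h⟩ := hS (ε / 2) (half_pos hε)
  obtain ⟨N₁, h₁⟩ := Metric.tendsto_atTop.1 (hS.memF_of_approx hX).tendsto (ε / 2) (half_pos hε)
  obtain ⟨A, hA, hXA⟩ := hX (max (N₀ + 1) N₁)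
  refine ⟨A, hA, ?_⟩
  have h2 := abs_lt.1 (h A hA _ (Nat.lt_of_succ_le (le_max_left (N₀ + 1) N₁)))
  have h3 := h₁ _ (le_max_right (N₀ + 1) N₁)
  rw [Real.dist_eq, nuN_congr hXA] at h3
  have h3 := abs_lt.1 h3
  exact abs_lt.2 ⟨by linarith, by linarith⟩

theorem IsChain.exists_agree_sUnion {S : Set (Set ℕ)} (hS : IsChain (· ⊆ ·) S)
    (hne : S.Nonempty) (N : ℕ) : ∃ A ∈ S, ∀ n ≤ N, n ∈ ⋃₀ S ↔ n ∈ A := by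
  obtain ⟨A, hA, h⟩ := hS.directedOn.exists_mem_subset_of_finite_of_subset_sUnion hne
    ((Set.finite_Iic N).inter_of_left (⋃₀ S)) Set.inter_subset_right
  exact ⟨A, hA, fun n hn => ⟨fun hX => h ⟨hn, hX⟩, fun hnA => ⟨A, hA, hnA⟩⟩⟩

theorem IsChain.exists_agree_sInter {S : Set (Set ℕ)} (hS : IsChain (· ⊆ ·) S)
    (hne : S.Nonempty) (N : ℕ) : ∃ A ∈ S, ∀ n ≤ N, n ∈ ⋂₀ S ↔ n ∈ A := by
  have hc : IsChain (· ⊆ ·) (compl '' S) := by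
    rintro _ ⟨A, hA, rfl⟩ _ ⟨B, hB, rfl⟩ _
    simpa only [Set.compl_subset_compl] using (hS.total hB hA)
  obtain ⟨_, ⟨A, hA, rfl⟩, h⟩ := hc.exists_agree_sUnion (hne.image _) N
  refine ⟨A, hA, fun n hn => ?_⟩
  have := h n hn
  rw [← Set.compl_sInter] at this
  simpa only [Set.mem_compl_iff, not_iff_not] using this

/-- Inserting a set of prescribed density into a uniformly convergent chain, when the chain has
members of smaller and of larger density. -/
theorem IsChain.exists_comparable_of_bounds {T : Set (Set ℕ)} (hT : IsChain (· ⊆ ·) T)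
    (hF : ∀ A ∈ T, memF A) (hu : UniformlyCesaro T) {t : ℝ}
    (hlo : ∃ A ∈ T, nu A ≤ t) (hhi : ∃ A ∈ T, t ≤ nu A) :
    ∃ D, Tendsto (nuN D) atTop (𝓝 t) ∧ ∀ A ∈ T, A ⊆ D ∨ D ⊆ A := by
  by_cases hex : ∃ A ∈ T, nu A = t
  · obtain ⟨A, hA, rfl⟩ := hex
    exact ⟨A, (hF A hA).tendsto, fun B hB => hT.total hB hA⟩
  push Not at hex
  obtain ⟨A₀, hA₀, hA₀t⟩ := hlo
  obtain ⟨A₁, hA₁, hA₁t⟩ := hhi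
  set P : Set (Set ℕ) := {A ∈ T | nu A < t} with hP
  set Q : Set (Set ℕ) := {A ∈ T | t < nu A} with hQ
  have hPT : P ⊆ T := Set.sep_subset _ _
  have hQT : Q ⊆ T := Set.sep_subset _ _
  have hL := (hT.mono hPT).exists_agree_sUnion ⟨A₀, hA₀, lt_of_le_of_ne hA₀t (hex _ hA₀)⟩
  have hR := (hT.mono hQT).exists_agree_sInter ⟨A₁, hA₁, lt_of_le_of_ne hA₁t (hex _ hA₁).symm⟩
  have hLt : nu (⋃₀ P) ≤ t := by
    refine le_of_forall_pos_lt_add fun ε hε => ?_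
    obtain ⟨A, hA, h⟩ := (hu.mono hPT).exists_nu_near hL hε
    linarith [(abs_lt.1 h).2, hA.2]
  have hRt : t ≤ nu (⋂₀ Q) := by
    refine le_of_forall_pos_lt_add fun ε hε => ?_
    obtain ⟨A, hA, h⟩ := (hu.mono hQT).exists_nu_near hR hε
    linarith [(abs_lt.1 h).1, hA.2]
  have hLR : ⋃₀ P ⊆ ⋂₀ Q := Set.sUnion_subset fun A hA => Set.subset_sInter fun B hB =>
    hT.subset_of_nu_lt hF hA.1 hB.1 (hA.2.trans hB.2)
  obtain ⟨D, hLD, hDR, hD⟩ := exists_between_tendsto_nuN hLR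
    ((hu.mono hPT).memF_of_approx hL).tendsto ((hu.mono hQT).memF_of_approx hR).tendsto hLt hRt
  refine ⟨D, hD, fun A hA => ?_⟩
  rcases lt_or_gt_of_ne (hex A hA) with h | h
  · exact Or.inl ((Set.subset_sUnion_of_mem (show A ∈ P from ⟨hA, h⟩)).trans hLD)
  · exact Or.inr (hDR.trans (Set.sInter_subset_of_mem (show A ∈ Q from ⟨hA, h⟩)))

/-- A uniformly convergent chain of sets with a Cesàro limit. -/
structure IsUniformChain (T : Set (Set ℕ)) : Prop where
  chain : IsChain (· ⊆ ·) T
  memF : ∀ A ∈ T, memF A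
  uniform : UniformlyCesaro T

theorem IsUniformChain.insert {T : Set (Set ℕ)} (hT : IsUniformChain T) {D : Set ℕ}
    (hD : _root_.memF D) (hcomp : ∀ A ∈ T, A ⊆ D ∨ D ⊆ A) : IsUniformChain (insert D T) where
  chain := hT.chain.insert fun A hA _ => (hcomp A hA).symm
  memF := Set.forall_mem_insert.2 ⟨hD, hT.memF⟩
  uniform := hT.uniform.insert hD

theorem IsUniformChain.exists_extension {T : Set (Set ℕ)} (hT : IsUniformChain T) {t : ℝ}
    (ht : t ∈ Set.Icc (0 : ℝ) 1) :
    ∃ T', IsUniformChain T' ∧ T ⊆ T' ∧ ∃ D ∈ T', nu D = t := by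
  have hT' := (hT.insert ⟨0, tendsto_nuN_empty⟩ fun A _ => Or.inr A.empty_subset).insert
    ⟨1, tendsto_nuN_univ⟩ fun A _ => Or.inl A.subset_univ
  obtain ⟨D, hD, hcomp⟩ := hT'.chain.exists_comparable_of_bounds hT'.memF hT'.uniform (t := t)
    ⟨∅, by simp, (nu_eq_of_tendsto tendsto_nuN_empty).trans_le ht.1⟩
    ⟨Set.univ, by simp, ht.2.trans_eq (nu_eq_of_tendsto tendsto_nuN_univ).symm⟩
  exact ⟨_, hT'.insert ⟨t, hD⟩ hcomp, fun A hA => by simp [hA], D, by simp, nu_eq_of_tendsto hD⟩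

/-- A uniformly convergent chain extends to a chain of sets with a Cesàro limit whose set of
limits is dense in `[0,1]`. -/
theorem IsUniformChain.exists_dense_extension {T : Set (Set ℕ)} (hT : IsUniformChain T) :
    ∃ V, IsChain (· ⊆ ·) V ∧ (∀ A ∈ V, _root_.memF A) ∧ T ⊆ V ∧
      ∀ a b : ℝ, 0 ≤ a → a < b → b ≤ 1 → ∃ D ∈ V, a < nu D ∧ nu D < b := by
  let q : ℕ → Set.Icc (0 : ℝ) 1 := TopologicalSpace.denseSeq _
  choose next hnext hsub D hD hnu using
    fun (S : {S : Set (Set ℕ) // IsUniformChain S}) (k : ℕ) => S.2.exists_extension (q k).2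
  let W : ℕ → {S : Set (Set ℕ) // IsUniformChain S} :=
    fun n => Nat.rec ⟨T, hT⟩ (fun k S => ⟨next S k, hnext S k⟩) n
  have hmono : Monotone fun n => (W n).1 := monotone_nat_of_le_succ fun n => hsub (W n) n
  refine ⟨⋃ n, (W n).1, ?_, ?_, Set.subset_iUnion (fun n => (W n).1) 0, ?_⟩
  · intro A hA B hB hne
    obtain ⟨m, hm⟩ := Set.mem_iUnion.1 hA
    obtain ⟨n, hn⟩ := Set.mem_iUnion.1 hB
    exact (W (max m n)).2.chain (hmono (le_max_left m n) hm) (hmono (le_max_right m n) hn) hne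
  · intro A hA
    obtain ⟨m, hm⟩ := Set.mem_iUnion.1 hA
    exact (W m).2.memF A hm
  · intro a b ha hab hb
    obtain ⟨c, hac, hcb⟩ := exists_between hab
    obtain ⟨k, hk⟩ := (TopologicalSpace.denseRange_denseSeq (Set.Icc (0 : ℝ) 1)).exists_mem_open
      ((isOpen_Ioo (a := a) (b := b)).preimage continuous_subtype_val)
      ⟨⟨c, by linarith, by linarith⟩, hac, hcb⟩
    refine ⟨D (W k) k, Set.mem_iUnion.2 ⟨k + 1, hD (W k) k⟩, ?_⟩
    rw [hnu]
    exact hk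

/-- A set comparable with sets of densely many densities has a Cesàro limit. -/
theorem memF_of_comparable {V : Set (Set ℕ)} (hV : ∀ A ∈ V, memF A)
    (hdense : ∀ a b : ℝ, 0 ≤ a → a < b → b ≤ 1 → ∃ D ∈ V, a < nu D ∧ nu D < b)
    {A : Set ℕ} (hA : ∀ D ∈ V, A ⊆ D ∨ D ⊆ A) : memF A := by
  refine tendsto_of_no_upcrossings dense_univ ?_
    (isBoundedUnder_of ⟨1, nuN_le_one A⟩) (isBoundedUnder_of ⟨0, nuN_nonneg A⟩)
  rintro a - b - hab ⟨hfa, hfb⟩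
  obtain ⟨M, hM⟩ := hfa.exists
  obtain ⟨N, hN⟩ := hfb.exists
  obtain ⟨D, hD, haD, hDb⟩ := hdense a b ((nuN_nonneg A M).trans hM.le) hab
    (hN.le.trans (nuN_le_one A N))
  rcases hA D hD with h | h
  · obtain ⟨n, hn, hn'⟩ := (hfb.and_eventually ((hV D hD).tendsto.eventually_lt_const hDb)).exists
    linarith [nuN_mono h n]
  · obtain ⟨n, hn, hn'⟩ := (hfa.and_eventually ((hV D hD).tendsto.eventually_const_lt haD)).exists
    linarith [nuN_mono h n]

theorem IsMaxChain.mem_of_forall_comparable {U : Set (Set ℕ)} (hU : IsMaxChain (· ⊆ ·) U)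
    {D : Set ℕ} (hD : ∀ A ∈ U, A ⊆ D ∨ D ⊆ A) : D ∈ U := by
  rw [hU.2 (hU.1.insert fun A hA _ => (hD A hA).symm) (Set.subset_insert D U)]
  exact Set.mem_insert D U

/-- A maximal chain whose densities are dense in `[0,1]` attains every value in `[0,1]`. -/
theorem IsMaxChain.nu_image_eq_Icc {U : Set (Set ℕ)} (hU : IsMaxChain (· ⊆ ·) U)
    (hF : ∀ A ∈ U, memF A)
    (hdense : ∀ a b : ℝ, 0 ≤ a → a < b → b ≤ 1 → ∃ D ∈ U, a < nu D ∧ nu D < b) :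
    nu '' U = Set.Icc (0 : ℝ) 1 := by
  refine Set.Subset.antisymm (Set.image_subset_iff.2 fun A hA => nu_mem_Icc (hF A hA)) ?_
  intro t ht
  set X : Set ℕ := ⋃₀ {A ∈ U | nu A < t}
  have hX : X ∈ U := by
    refine hU.mem_of_forall_comparable fun B hB => ?_
    by_cases h : ∀ A ∈ U, nu A < t → A ⊆ B
    · exact Or.inr (Set.sUnion_subset fun A hA => h A hA.1 hA.2)
    · push Not at h
      obtain ⟨A, hA, hAt, hAB⟩ := h
      exact Or.inl (((hU.1.total hA hB).resolve_left hAB).trans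
        (Set.subset_sUnion_of_mem (show A ∈ {A ∈ U | nu A < t} from ⟨hA, hAt⟩)))
  have hX01 := nu_mem_Icc (hF X hX)
  refine ⟨X, hX, ?_⟩
  rcases lt_trichotomy (nu X) t with h | h | h
  · obtain ⟨D, hD, h1, h2⟩ := hdense _ _ hX01.1 h ht.2
    have hDX : D ⊆ X := Set.subset_sUnion_of_mem (show D ∈ {A ∈ U | nu A < t} from ⟨hD, h2⟩)
    exact absurd (nu_mono (hF D hD) (hF X hX) hDX) h1.not_ge
  · exact h
  · obtain ⟨D, hD, h1, h2⟩ := hdense _ _ ht.1 h hX01.2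
    have hXD : X ⊆ D := Set.sUnion_subset fun A hA =>
      hU.1.subset_of_nu_lt hF hA.1 hD (hA.2.trans h1)
    exact absurd (nu_mono (hF X hX) (hF D hD) hXD) h2.not_ge

theorem IsChain.uniformlyCesaro_of_nu_image_eq_Icc {U : Set (Set ℕ)} (hU : IsChain (· ⊆ ·) U)
    (hF : ∀ A ∈ U, memF A) (himg : nu '' U = Set.Icc (0 : ℝ) 1) : UniformlyCesaro U := by
  intro ε hε
  obtain ⟨m, hm⟩ := exists_nat_one_div_lt (half_pos hε)
  set k : ℕ := m + 1
  have hk : (0 : ℝ) < k := by positivity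
  have hkε : 1 / (k : ℝ) < ε / 2 := by simpa [k] using hm
  have hex : ∀ i : ℕ, ∃ D, i ≤ k → D ∈ U ∧ nu D = i / k := by
    intro i
    by_cases hi : i ≤ k
    · have : (i / k : ℝ) ∈ nu '' U := by
        rw [himg]
        exact ⟨by positivity, div_le_one_of_le₀ (by exact_mod_cast hi) hk.le⟩
      obtain ⟨D, hD, h⟩ := this
      exact ⟨D, fun _ => ⟨hD, h⟩⟩
    · exact ⟨∅, fun h => absurd h hi⟩
  choose D hD using hex
  have hev : ∀ᶠ N in atTop, ∀ i ∈ Finset.range (k + 1), |nuN (D i) N - nu (D i)| < ε / 2 := by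
    rw [eventually_all_finset]
    intro i hi
    have := hD i (Finset.mem_range_succ_iff.1 hi)
    exact Metric.tendsto_nhds.1 (hF _ this.1).tendsto _ (half_pos hε)
  obtain ⟨N₀, hN₀⟩ := eventually_atTop.1 hev
  refine ⟨N₀, fun A hA N hN => ?_⟩
  have hA01 := nu_mem_Icc (hF A hA)
  have hnear : ∀ i ≤ k, |nuN (D i) N - i / k| < ε / 2 := fun i hi => by
    rw [← (hD i hi).2]
    exact hN₀ N hN.le i (Finset.mem_range_succ_iff.2 hi)
  have hlower : nu A - ε < nuN A N := by
    rcases hA01.1.eq_or_lt with h0 | h0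
    · linarith [nuN_nonneg A N]
    obtain ⟨i, hi⟩ : ∃ i, ⌈nu A * k⌉₊ = i + 1 :=
      Nat.exists_eq_add_one.2 (Nat.ceil_pos.2 (by positivity))
    have h1 : (i : ℝ) < nu A * k := Nat.lt_ceil.1 (by omega)
    have h2 : nu A * k ≤ i + 1 := by
      have := Nat.le_ceil (nu A * k)
      rw [hi] at this
      exact_mod_cast this
    have hik : i ≤ k := by
      have : (i : ℝ) ≤ k := by nlinarith [hA01.2]
      exact_mod_cast this
    have h3 : (i : ℝ) / k < nu A := (div_lt_iff₀ hk).2 h1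
    have h4 : nu A ≤ i / k + 1 / k := by
      rw [← add_div]
      exact (le_div_iff₀ hk).2 h2
    have hsub := hU.subset_of_nu_lt hF (hD i hik).1 hA ((hD i hik).2.trans_lt h3)
    linarith [nuN_mono hsub N, (abs_lt.1 (hnear i hik)).1]
  have hupper : nuN A N < nu A + ε := by
    rcases hA01.2.eq_or_lt with h0 | h0
    · linarith [nuN_le_one A N]
    set i := ⌊nu A * k⌋₊
    have h1 : (i : ℝ) ≤ nu A * k := Nat.floor_le (mul_nonneg hA01.1 hk.le)
    have h2 : nu A * k < (i + 1 : ℕ) := by exact_mod_cast Nat.lt_floor_add_one (nu A * k)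
    have hik : i + 1 ≤ k := by
      have : (i : ℝ) < k := by nlinarith
      exact_mod_cast this
    have h3 : nu A < (i + 1 : ℕ) / k := (lt_div_iff₀ hk).2 h2
    have h4 : ((i + 1 : ℕ) : ℝ) / k ≤ nu A + 1 / k := by
      push_cast
      rw [add_div]
      gcongr
      exact (div_le_iff₀ hk).2 h1
    have hsub := hU.subset_of_nu_lt hF hA (hD _ hik).1 (h3.trans_eq (hD _ hik).2.symm)
    linarith [nuN_mono hsub N, (abs_lt.1 (hnear _ hik)).2]
  exact abs_lt.2 ⟨by linarith, by linarith⟩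

theorem stmt8 (T : Set (Set ℕ)) (hchain : IsChain (· ⊆ ·) T) (hT : ∀ A ∈ T, memF A) :
    (∀ ε : ℝ, 0 < ε → ∃ N₀ : ℕ, ∀ A ∈ T, ∀ N : ℕ, N₀ < N → |nuN A N - nu A| < ε) ↔
    ∃ U : Set (Set ℕ), IsMaxChain (· ⊆ ·) U ∧ (∀ A ∈ U, memF A) ∧ T ⊆ U ∧
      nu '' U = Set.Icc (0 : ℝ) 1 := by
  constructor
  · intro hu
    obtain ⟨V, hV, hVF, hTV, hdense⟩ :=
      (IsUniformChain.mk hchain hT hu).exists_dense_extension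
    obtain ⟨U, hU, hVU⟩ := IsChain.exists_maxChain hV
    have hUF : ∀ A ∈ U, memF A := fun A hA =>
      memF_of_comparable hVF hdense fun D hD => hU.1.total hA (hVU hD)
    refine ⟨U, hU, hUF, hTV.trans hVU, hU.nu_image_eq_Icc hUF fun a b ha hab hb => ?_⟩
    obtain ⟨D, hD, h⟩ := hdense a b ha hab hb
    exact ⟨D, hVU hD, h⟩
  · rintro ⟨U, hU, hUF, hTU, himg⟩
    exact (hU.1.uniformlyCesaro_of_nu_image_eq_Icc hUF himg).mono hTU
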